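/- arXiv:1307.3660 — 11 statements merged into one kernel-verified Lean document; each statement's English description precedes it below -/
import Mathlib

section
/- Let V be a real vector space, J : V → V a linear map, and Q : V* → V a linear map that anticommutes with J (i.e. J ∘ Q = -Q ∘ J*, where (J*α)(x) = -α(Jx)). Let n ≥ 1 and let ω₁, ω₂, … be linear maps V → V*. Suppose that for every i with 1 ≤ i < n one has J* ∘ ω_i - ω_i ∘ J = Σ_{k+l=i, k,l≥1} ω_k ∘ Q ∘ ω_l. Then Σ_{i+j=n, i,j≥1} ( J* ∘ ω_i ∘ Q ∘ ω_j + ω_i ∘ Q ∘ ω_j ∘ J ) = 0. -/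
/-- Two ways of summing over the compositions of `n` into three positive parts. -/
theorem sum_Ioo_sum_Ioo_assoc {M : Type*} [AddCommMonoid M] (n : ℕ) (f : ℕ → ℕ → ℕ → M) :
    ∑ i ∈ Finset.Ioo 0 n, ∑ k ∈ Finset.Ioo 0 i, f k (i - k) (n - i) =
      ∑ i ∈ Finset.Ioo 0 n, ∑ k ∈ Finset.Ioo 0 (n - i), f i k (n - i - k) := by
  rw [Finset.sum_sigma', Finset.sum_sigma']
  refine Finset.sum_bij' (fun p _ => ⟨p.2, p.1 - p.2⟩) (fun p _ => ⟨p.1 + p.2, p.1⟩)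
    ?_ ?_ ?_ ?_ ?_
  · rintro ⟨i, k⟩ h
    simp only [Finset.mem_sigma, Finset.mem_Ioo] at h ⊢
    omega
  · rintro ⟨i, k⟩ h
    simp only [Finset.mem_sigma, Finset.mem_Ioo] at h ⊢
    omega
  · rintro ⟨i, k⟩ h
    simp only [Finset.mem_sigma, Finset.mem_Ioo] at h
    simp only [Sigma.mk.injEq, heq_eq_eq, and_true]
    omega
  · rintro ⟨i, k⟩ h
    simp
  · rintro ⟨i, k⟩ h
    simp only [Finset.mem_sigma, Finset.mem_Ioo] at h
    simp only [show n - k - (i - k) = n - i by omega]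

/-- Summed over compositions of `n`, refining the first part cancels refining the second. -/
theorem sum_Ioo_sub_sum_Ioo_eq_zero {M : Type*} [AddCommGroup M] (n : ℕ) (f : ℕ → ℕ → ℕ → M) :
    ∑ i ∈ Finset.Ioo 0 n, (∑ k ∈ Finset.Ioo 0 i, f k (i - k) (n - i) -
      ∑ k ∈ Finset.Ioo 0 (n - i), f i k (n - i - k)) = 0 := by
  rw [Finset.sum_sub_distrib, sum_Ioo_sum_Ioo_assoc, sub_self]


/-- The vanishing of the (1,1)-part in the inductive construction
(Lemma 3.1 of the paper, pointwise linear-algebra content). -/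
theorem stmt_0 (V : Type*) [AddCommGroup V] [Module ℝ V]
    (J : V →ₗ[ℝ] V)
    (Js : Module.Dual ℝ V →ₗ[ℝ] Module.Dual ℝ V)
    (hJs : ∀ (α : Module.Dual ℝ V) (x : V), Js α x = -α (J x))
    (Q : Module.Dual ℝ V →ₗ[ℝ] V)
    (hQ : J ∘ₗ Q = -(Q ∘ₗ Js))
    (n : ℕ) (hn : 1 ≤ n)
    (ω : ℕ → (V →ₗ[ℝ] Module.Dual ℝ V))
    (hind : ∀ i, 1 ≤ i → i < n →
      Js ∘ₗ ω i - (ω i) ∘ₗ J = ∑ k ∈ Finset.Ioo 0 i, (ω k) ∘ₗ Q ∘ₗ (ω (i - k))) :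
    ∑ i ∈ Finset.Ioo 0 n,
      (Js ∘ₗ ((ω i) ∘ₗ Q ∘ₗ (ω (n - i))) + ((ω i) ∘ₗ Q ∘ₗ (ω (n - i))) ∘ₗ J) = 0 := by
  have hJQ (α : Module.Dual ℝ V) : J (Q α) = -Q (Js α) := LinearMap.congr_fun hQ α
  have key : ∀ i ∈ Finset.Ioo 0 n,
      Js ∘ₗ (ω i ∘ₗ Q ∘ₗ ω (n - i)) + (ω i ∘ₗ Q ∘ₗ ω (n - i)) ∘ₗ J =
        ∑ k ∈ Finset.Ioo 0 i, ω k ∘ₗ Q ∘ₗ ω (i - k) ∘ₗ Q ∘ₗ ω (n - i) -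
        ∑ k ∈ Finset.Ioo 0 (n - i), ω i ∘ₗ Q ∘ₗ ω k ∘ₗ Q ∘ₗ ω (n - i - k) := by
    intro i hi
    rw [Finset.mem_Ioo] at hi
    refine LinearMap.ext fun x => ?_
    have h₁ := LinearMap.congr_fun (hind i (by omega) (by omega)) (Q (ω (n - i) x))
    have h₂ := congrArg (fun α => ω i (Q α))
      (LinearMap.congr_fun (hind (n - i) (by omega) (by omega)) x)
    simp only [LinearMap.sub_apply, LinearMap.add_apply, LinearMap.sum_apply,
      LinearMap.comp_apply, map_sub, map_sum, hJQ, map_neg] at h₁ h₂ ⊢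
    rw [← h₁, ← h₂]
    abel
  rw [Finset.sum_congr rfl key]
  exact sum_Ioo_sub_sum_Ioo_eq_zero n fun a b c => ω a ∘ₗ Q ∘ₗ ω b ∘ₗ Q ∘ₗ ω c
end

section
/- Suppose J ∘ J = -id, Q anticommutes with J (J ∘ Q = -Q ∘ J*), and the relation ω ∘ J - J* ∘ ω + ω ∘ Q ∘ ω = 0 holds. Then the linear map J₋ := -J - Q ∘ ω satisfies J₋ ∘ J₋ = -id, i.e. J₋ is again a linear complex structure on V. -/
/-- J₋ := -J - Q ∘ ω is again a linear complex structure
(part (i) of Proposition 2 of the paper, pointwise content). -/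
theorem stmt_1 (V : Type*) [AddCommGroup V] [Module ℝ V]
    (J : V →ₗ[ℝ] V)
    (Js : Module.Dual ℝ V →ₗ[ℝ] Module.Dual ℝ V)
    (hJs : ∀ (α : Module.Dual ℝ V) (x : V), Js α x = -α (J x))
    (Q : Module.Dual ℝ V →ₗ[ℝ] V)
    (ω : V →ₗ[ℝ] Module.Dual ℝ V)
    (hJ : J ∘ₗ J = -LinearMap.id)
    (hQ : J ∘ₗ Q = -(Q ∘ₗ Js))
    (hrel : ω ∘ₗ J - Js ∘ₗ ω + ω ∘ₗ Q ∘ₗ ω = 0) :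
    (-J - Q ∘ₗ ω) ∘ₗ (-J - Q ∘ₗ ω) = -LinearMap.id := by
  ext x
  have h₁ : J (J x) = -x := LinearMap.congr_fun hJ x
  have h₂ : J (Q (ω x)) = -Q (Js (ω x)) := LinearMap.congr_fun hQ (ω x)
  have h₃ : Q (ω (J x)) - Q (Js (ω x)) + Q (ω (Q (ω x))) = 0 := by
    simpa using congrArg Q (LinearMap.congr_fun hrel x)
  simp only [LinearMap.comp_apply, LinearMap.sub_apply, LinearMap.neg_apply, LinearMap.id_apply,
    map_sub, map_neg, h₁, h₂]
  linear_combination (norm := module) h₃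
end

section
/- Suppose ω is alternating and the relation ω ∘ J - J* ∘ ω + ω ∘ Q ∘ ω = 0 holds. Then the bilinear form g(x,y) := -(1/2) ω((J - J₋)x)(y), where J₋ := -J - Q ∘ ω, satisfies g(x,y) = (1/2)( ω(x, J y) - ω(J x, y) ) for all x, y; in particular g is symmetric: g(x,y) = g(y,x). -/
/-- the bilinear form g is given by the J-invariant part of ω
and is symmetric (part (ii) of Proposition 2 of the paper, pointwise content). -/
theorem stmt_3 (V : Type*) [AddCommGroup V] [Module ℝ V]
    (J : V →ₗ[ℝ] V)
    (Js : Module.Dual ℝ V →ₗ[ℝ] Module.Dual ℝ V)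
    (hJs : ∀ (α : Module.Dual ℝ V) (x : V), Js α x = -α (J x))
    (Q : Module.Dual ℝ V →ₗ[ℝ] V)
    (ω : V →ₗ[ℝ] Module.Dual ℝ V)
    (halt : ∀ x y : V, ω x y = -ω y x)
    (hrel : ω ∘ₗ J - Js ∘ₗ ω + ω ∘ₗ Q ∘ₗ ω = 0)
    (g : V → V → ℝ)
    (hg : ∀ x y : V, g x y = -(1/2 : ℝ) * ω ((J - (-J - Q ∘ₗ ω)) x) y) :
    (∀ x y : V, g x y = (1/2 : ℝ) * (ω x (J y) - ω (J x) y)) ∧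
      ∀ x y : V, g x y = g y x := by
  have key : ∀ x y : V, g x y = (1/2 : ℝ) * (ω x (J y) - ω (J x) y) := by
    intro x y
    have h := LinearMap.congr_fun (LinearMap.congr_fun hrel x) y
    simp only [LinearMap.add_apply, LinearMap.sub_apply, LinearMap.comp_apply, hJs,
      LinearMap.zero_apply] at h
    simp only [hg, LinearMap.sub_apply, LinearMap.neg_apply, LinearMap.comp_apply, map_sub, map_neg]
    linarith
  refine ⟨key, fun x y => ?_⟩
  rw [key, key, halt x (J y), halt y (J x)]
  ring
end

section
/- Suppose ω is alternating and the relation ω ∘ J - J* ∘ ω + ω ∘ Q ∘ ω = 0 holds. Then the bilinear form g(x,y) := -(1/2) ω((J - J₋)x)(y), where J₋ := -J - Q ∘ ω, satisfies g(x,x) = ω(x, J x) for every x ∈ V. Consequently, if the J-invariant part of ω is positive definite in the sense that ω(x, J x) > 0 for all x ≠ 0, then g is positive definite. -/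
/-- g(x,x) = ω(x,Jx), so g is positive definite when the
J-invariant part of ω is (part (ii) of Proposition 2 of the paper). -/
theorem stmt_4 (V : Type*) [AddCommGroup V] [Module ℝ V]
    (J : V →ₗ[ℝ] V)
    (Js : Module.Dual ℝ V →ₗ[ℝ] Module.Dual ℝ V)
    (hJs : ∀ (α : Module.Dual ℝ V) (x : V), Js α x = -α (J x))
    (Q : Module.Dual ℝ V →ₗ[ℝ] V)
    (ω : V →ₗ[ℝ] Module.Dual ℝ V)
    (halt : ∀ x y : V, ω x y = -ω y x)
    (hrel : ω ∘ₗ J - Js ∘ₗ ω + ω ∘ₗ Q ∘ₗ ω = 0)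
    (g : V → V → ℝ)
    (hg : ∀ x y : V, g x y = -(1/2 : ℝ) * ω ((J - (-J - Q ∘ₗ ω)) x) y) :
    (∀ x : V, g x x = ω x (J x)) ∧
      ((∀ x : V, x ≠ 0 → 0 < ω x (J x)) → ∀ x : V, x ≠ 0 → 0 < g x x) := by
  have h : ∀ x : V, g x x = ω x (J x) := by
    intro x
    have hx := LinearMap.congr_fun (LinearMap.congr_fun hrel x) x
    simp only [LinearMap.add_apply, LinearMap.sub_apply, LinearMap.comp_apply,
      LinearMap.zero_apply, hJs] at hx
    rw [hg]
    simp only [LinearMap.sub_apply, LinearMap.neg_apply, LinearMap.comp_apply, map_sub, map_neg]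
    linarith [halt (J x) x]
  exact ⟨h, fun hpos x hx => (h x).symm ▸ hpos x hx⟩
end

section
/- Suppose J ∘ J = -id, ω is alternating, and the relation ω ∘ J - J* ∘ ω + ω ∘ Q ∘ ω = 0 holds. Then the bilinear form g(x,y) := -(1/2) ω((J - J₋)x)(y), with J₋ := -J - Q ∘ ω, is J-invariant: g(J x, J y) = g(x,y) for all x, y ∈ V. -/
/-- g is J-invariant (part (iii) of Proposition 2 of the paper). -/
theorem stmt_5 (V : Type*) [AddCommGroup V] [Module ℝ V]
    (J : V →ₗ[ℝ] V)
    (Js : Module.Dual ℝ V →ₗ[ℝ] Module.Dual ℝ V)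
    (hJs : ∀ (α : Module.Dual ℝ V) (x : V), Js α x = -α (J x))
    (Q : Module.Dual ℝ V →ₗ[ℝ] V)
    (ω : V →ₗ[ℝ] Module.Dual ℝ V)
    (hJ : J ∘ₗ J = -LinearMap.id)
    (halt : ∀ x y : V, ω x y = -ω y x)
    (hrel : ω ∘ₗ J - Js ∘ₗ ω + ω ∘ₗ Q ∘ₗ ω = 0)
    (g : V → V → ℝ)
    (hg : ∀ x y : V, g x y = -(1/2 : ℝ) * ω ((J - (-J - Q ∘ₗ ω)) x) y) :
    ∀ x y : V, g (J x) (J y) = g x y := by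
  have hJJ (x : V) : J (J x) = -x := by simpa using LinearMap.congr_fun hJ x
  have hrel' (x y : V) : ω (J x) y + ω x (J y) + ω (Q (ω x)) y = 0 := by
    simpa [hJs] using LinearMap.congr_fun (LinearMap.congr_fun hrel x) y
  have hg' (x y : V) : g x y = -(1/2 : ℝ) * (ω (J x) y - ω x (J y)) := by
    have hexp : ω ((J - (-J - Q ∘ₗ ω)) x) y = 2 * ω (J x) y + ω (Q (ω x)) y := by
      simp only [LinearMap.sub_apply, LinearMap.neg_apply, LinearMap.comp_apply, map_sub, map_neg]
      ring
    rw [hg, hexp]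
    linarith [hrel' x y]
  intro x y
  rw [hg', hg', hJJ, hJJ, map_neg, map_neg, LinearMap.neg_apply]
  ring
end

section
/- Suppose J ∘ J = -id, ω is alternating, Q anticommutes with J (J ∘ Q = -Q ∘ J*), and the relation ω ∘ J - J* ∘ ω + ω ∘ Q ∘ ω = 0 holds. Then the bilinear form g(x,y) := -(1/2) ω((J - J₋)x)(y), with J₋ := -J - Q ∘ ω, is J₋-invariant: g(J₋ x, J₋ y) = g(x,y) for all x, y ∈ V. -/
/-- g is J₋-invariant (part (iii) of Proposition 2 of the paper). -/
theorem stmt_6 (V : Type*) [AddCommGroup V] [Module ℝ V]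
    (J : V →ₗ[ℝ] V)
    (Js : Module.Dual ℝ V →ₗ[ℝ] Module.Dual ℝ V)
    (hJs : ∀ (α : Module.Dual ℝ V) (x : V), Js α x = -α (J x))
    (Q : Module.Dual ℝ V →ₗ[ℝ] V)
    (ω : V →ₗ[ℝ] Module.Dual ℝ V)
    (hJ : J ∘ₗ J = -LinearMap.id)
    (halt : ∀ x y : V, ω x y = -ω y x)
    (hQ : J ∘ₗ Q = -(Q ∘ₗ Js))
    (hrel : ω ∘ₗ J - Js ∘ₗ ω + ω ∘ₗ Q ∘ₗ ω = 0)
    (g : V → V → ℝ)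
    (hg : ∀ x y : V, g x y = -(1/2 : ℝ) * ω ((J - (-J - Q ∘ₗ ω)) x) y) :
    ∀ x y : V, g ((-J - Q ∘ₗ ω) x) ((-J - Q ∘ₗ ω) y) = g x y := by
  have hJJ : ∀ x, J (J x) = -x := fun x => by simpa using LinearMap.congr_fun hJ x
  set K := -J - Q ∘ₗ ω with hK
  have hKJ : ∀ x y, ω (K x) y = ω x (J y) := fun x y => by
    have h := LinearMap.congr_fun (LinearMap.congr_fun hrel x) y
    simp only [LinearMap.add_apply, LinearMap.sub_apply, LinearMap.comp_apply, hJs,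
      LinearMap.zero_apply] at h
    simp only [hK, LinearMap.sub_apply, LinearMap.neg_apply, LinearMap.comp_apply, map_sub, map_neg]
    linarith
  have hJK : ∀ x y, ω x (K y) = ω (J x) y := fun x y => by
    rw [halt, hKJ, halt (J x) y]
  intro x y
  simp only [hg, LinearMap.sub_apply, map_sub]
  rw [hJK (J (K x)), hKJ (K x), hKJ x (J (K y)), hJJ, hJJ, map_neg, map_neg,
    LinearMap.neg_apply, hJK, hKJ]
  ring
end

section
/- Let V be a finite-dimensional real vector space. Suppose J ∘ J = -id, ω is alternating with ω(x, J x) > 0 for all x ≠ 0, and Q anticommutes with J (J ∘ Q = -Q ∘ J*). If the composite Q ∘ ω : V → V commutes with J, i.e. J ∘ (Q ∘ ω) = (Q ∘ ω) ∘ J, then Q = 0. -/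
/-- if Q ∘ ω commutes with J then Q vanishes
(linear-algebra step in the proof of part (iii) of Proposition 2 of the paper). -/
theorem stmt_7 (V : Type*) [AddCommGroup V] [Module ℝ V] [FiniteDimensional ℝ V]
    (J : V →ₗ[ℝ] V)
    (Js : Module.Dual ℝ V →ₗ[ℝ] Module.Dual ℝ V)
    (hJs : ∀ (α : Module.Dual ℝ V) (x : V), Js α x = -α (J x))
    (Q : Module.Dual ℝ V →ₗ[ℝ] V)
    (ω : V →ₗ[ℝ] Module.Dual ℝ V)
    (hJ : J ∘ₗ J = -LinearMap.id)
    (halt : ∀ x y : V, ω x y = -ω y x)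
    (hpos : ∀ x : V, x ≠ 0 → 0 < ω x (J x))
    (hQ : J ∘ₗ Q = -(Q ∘ₗ Js))
    (hcomm : J ∘ₗ (Q ∘ₗ ω) = (Q ∘ₗ ω) ∘ₗ J) :
    Q = 0 := by
  set T : V →ₗ[ℝ] Module.Dual ℝ V := Js ∘ₗ ω + ω ∘ₗ J with hT
  have hinj : Function.Injective T := by
    rw [injective_iff_map_eq_zero]
    intro x hx
    by_contra hne
    have hxx : T x x = 0 := by rw [hx, LinearMap.zero_apply]
    simp only [hT, LinearMap.add_apply, LinearMap.comp_apply, hJs] at hxx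
    linarith [hpos x hne, halt (J x) x]
  have hsurj : Function.Surjective T :=
    (LinearMap.injective_iff_surjective_of_finrank_eq_finrank
      Subspace.dual_finrank_eq.symm).mp hinj
  ext α
  obtain ⟨x, rfl⟩ := hsurj α
  have hQx : J (Q (ω x)) = -Q (Js (ω x)) := LinearMap.congr_fun hQ (ω x)
  have hcx : J (Q (ω x)) = Q (ω (J x)) := LinearMap.congr_fun hcomm x
  simp only [hT, LinearMap.add_apply, LinearMap.comp_apply, LinearMap.zero_apply]
  rw [map_add, ← hcx, hQx, add_neg_cancel]
end

section
/- Let V be a nonzero finite-dimensional real vector space. Suppose J ∘ J = -id, ω is alternating with ω(x, J x) > 0 for all x ≠ 0, and Q anticommutes with J (J ∘ Q = -Q ∘ J*). Then J₋ := -J - Q ∘ ω satisfies J₋ ≠ J. -/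
/-- J₋ := -J - Q ∘ ω never equals J
(pointwise content of part (iii) of Proposition 2 of the paper). -/
theorem stmt_8 (V : Type*) [AddCommGroup V] [Module ℝ V]
    [FiniteDimensional ℝ V] [Nontrivial V]
    (J : V →ₗ[ℝ] V)
    (Js : Module.Dual ℝ V →ₗ[ℝ] Module.Dual ℝ V)
    (hJs : ∀ (α : Module.Dual ℝ V) (x : V), Js α x = -α (J x))
    (Q : Module.Dual ℝ V →ₗ[ℝ] V)
    (ω : V →ₗ[ℝ] Module.Dual ℝ V)
    (hJ : J ∘ₗ J = -LinearMap.id)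
    (halt : ∀ x y : V, ω x y = -ω y x)
    (hpos : ∀ x : V, x ≠ 0 → 0 < ω x (J x))
    (hQ : J ∘ₗ Q = -(Q ∘ₗ Js)) :
    -J - Q ∘ₗ ω ≠ J := by
  intro h
  have hJJ (x : V) : J (J x) = -x := by simpa using LinearMap.congr_fun hJ x
  have hQω (x : V) : Q (ω x) = -((2 : ℝ) • J x) := by
    have hx : -J x - Q (ω x) = J x := by simpa using LinearMap.congr_fun h x
    rw [sub_eq_iff_eq_add'] at hx
    rw [two_smul, neg_add, ← sub_eq_add_neg]
    exact eq_sub_of_add_eq hx.symm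
  have hinj : Function.Injective ω := by
    refine (injective_iff_map_eq_zero ω).2 fun x hx => ?_
    by_contra hne
    simpa [hx] using hpos x hne
  have hsurj : Function.Surjective ω :=
    (LinearMap.injective_iff_surjective_of_finrank_eq_finrank
      Subspace.dual_finrank_eq.symm).1 hinj
  obtain ⟨x, hx⟩ := exists_ne (0 : V)
  obtain ⟨z, hz⟩ := hsurj (Js (ω x))
  have hJQ : J (Q (ω x)) = -Q (Js (ω x)) := by
    simpa using LinearMap.congr_fun hQ (ω x)
  have hJz : J z = x := by
    rw [← hz, hQω, hQω, map_neg, map_smul, hJJ, smul_neg, neg_neg, neg_neg] at hJQ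
    exact (smul_right_injective V (two_ne_zero' ℝ) hJQ).symm
  have hz' : z = -J x := by rw [← hJz, hJJ, neg_neg]
  have hval : ω z x = -ω x (J x) := by rw [hz, hJs]
  rw [hz', map_neg, LinearMap.neg_apply] at hval
  linarith [hpos x hx, halt x (J x)]
end

section
/- For every natural number n ≥ 2, one has Σ_{i=1}^{n-1} 1/(i² (n-i)²) ≤ 16/n². -/
/-- the elementary estimate Σ_{i=1}^{n-1} 1/(i²(n-i)²) ≤ 16/n². -/
theorem stmt_11 (n : ℕ) (hn : 2 ≤ n) :
    ∑ i ∈ Finset.Ioo 0 n, (1 : ℝ) / ((i : ℝ) ^ 2 * ((n - i : ℕ) : ℝ) ^ 2) ≤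
      16 / (n : ℝ) ^ 2 := by
  have hsum : ∑ i ∈ Finset.Ioo 0 n, ((i : ℝ) ^ 2)⁻¹ ≤ 2 := by
    simpa using sum_Ioo_inv_sq_le (α := ℝ) 0 n
  have hrefl : ∑ i ∈ Finset.Ioo 0 n, (((n - i : ℕ) : ℝ) ^ 2)⁻¹ =
      ∑ i ∈ Finset.Ioo 0 n, ((i : ℝ) ^ 2)⁻¹ := by
    refine Finset.sum_nbij' (fun i => n - i) (fun i => n - i) ?_ ?_ ?_ ?_ ?_ <;>
      simp only [Finset.mem_Ioo] <;> intros <;> first | omega | trivial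
  have hn0 : (0 : ℝ) < n := by exact_mod_cast (by omega : 0 < n)
  have hterm : ∀ i ∈ Finset.Ioo 0 n,
      (1 : ℝ) / ((i : ℝ) ^ 2 * ((n - i : ℕ) : ℝ) ^ 2) ≤
        2 / (n : ℝ) ^ 2 * (((i : ℝ) ^ 2)⁻¹ + (((n - i : ℕ) : ℝ) ^ 2)⁻¹) := by
    intro i hi
    obtain ⟨hi0, hin⟩ := Finset.mem_Ioo.mp hi
    have ha : (0 : ℝ) < i := by exact_mod_cast hi0
    have hb : (0 : ℝ) < (n - i : ℕ) := by exact_mod_cast Nat.sub_pos_of_lt hin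
    have hab : (n : ℝ) = i + (n - i : ℕ) := by exact_mod_cast (by omega : n = i + (n - i))
    generalize ((n - i : ℕ) : ℝ) = b at *
    generalize (i : ℝ) = a at *
    have hrhs : 2 / (n : ℝ) ^ 2 * ((a ^ 2)⁻¹ + (b ^ 2)⁻¹) =
        2 * (a ^ 2 + b ^ 2) / (n : ℝ) ^ 2 / (a ^ 2 * b ^ 2) := by
      field_simp
      ring
    rw [hrhs]
    gcongr
    rw [one_le_div (by positivity), hab]
    nlinarith [sq_nonneg (a - b)]
  calc _ ≤ ∑ i ∈ Finset.Ioo 0 n,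
        2 / (n : ℝ) ^ 2 * (((i : ℝ) ^ 2)⁻¹ + (((n - i : ℕ) : ℝ) ^ 2)⁻¹) :=
        Finset.sum_le_sum hterm
    _ = 4 / (n : ℝ) ^ 2 * ∑ i ∈ Finset.Ioo 0 n, ((i : ℝ) ^ 2)⁻¹ := by
        rw [← Finset.mul_sum, Finset.sum_add_distrib, hrefl]
        ring
    _ ≤ 4 / (n : ℝ) ^ 2 * 4 := by
        gcongr
        linarith
    _ = 16 / (n : ℝ) ^ 2 := by ring
end

section
/- Let C > 0 and let a : ℕ → ℝ be a sequence with a(n) ≥ 0 for all n, a(1) > 0, and a(n) ≤ C · Σ_{i=1}^{n-1} a(i) · a(n-i) for every n ≥ 2. Then for every n ≥ 1, a(n) ≤ (16 C a(1))ⁿ / (16 C n²). -/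
/-- A sum over `0 < i < n` is invariant under `i ↦ n - i`. -/
theorem sum_Ioo_zero_reflect (f : ℕ → ℝ) (n : ℕ) :
    ∑ i ∈ Finset.Ioo 0 n, f (n - i) = ∑ i ∈ Finset.Ioo 0 n, f i := by
  refine Finset.sum_nbij' (fun i => n - i) (fun i => n - i) ?_ ?_ ?_ ?_ ?_
  all_goals intro i hi; simp only [Finset.mem_Ioo] at *
  all_goals omega

/-- The convolution square of `1 / n ^ 2` is at most `8 / n ^ 2`. -/
theorem sum_Ioo_inv_sq_mul_inv_sq_le (n : ℕ) :
    ∑ i ∈ Finset.Ioo 0 n, ((i : ℝ) ^ 2)⁻¹ * (((n - i : ℕ) : ℝ) ^ 2)⁻¹ ≤ 8 / (n : ℝ) ^ 2 := by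
  have hsum : ∑ i ∈ Finset.Ioo 0 n, ((i : ℝ) ^ 2)⁻¹ ≤ 2 := by
    simpa using sum_Ioo_inv_sq_le (α := ℝ) 0 n
  calc ∑ i ∈ Finset.Ioo 0 n, ((i : ℝ) ^ 2)⁻¹ * (((n - i : ℕ) : ℝ) ^ 2)⁻¹
      ≤ ∑ i ∈ Finset.Ioo 0 n,
          2 / (n : ℝ) ^ 2 * (((i : ℝ) ^ 2)⁻¹ + (((n - i : ℕ) : ℝ) ^ 2)⁻¹) := by
        refine Finset.sum_le_sum fun i hi => ?_
        obtain ⟨h0, hin⟩ := Finset.mem_Ioo.mp hi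
        have hx : (0 : ℝ) < i := by exact_mod_cast h0
        have hy : (0 : ℝ) < (n - i : ℕ) := by exact_mod_cast Nat.sub_pos_of_lt hin
        have hn : (n : ℝ) = i + (n - i : ℕ) := by
          exact_mod_cast (Nat.add_sub_of_le hin.le).symm
        rw [hn]
        generalize (i : ℝ) = x at *
        generalize ((n - i : ℕ) : ℝ) = y at *
        have : 2 / (x + y) ^ 2 * ((x ^ 2)⁻¹ + (y ^ 2)⁻¹) - (x ^ 2)⁻¹ * (y ^ 2)⁻¹
            = (x - y) ^ 2 / ((x + y) ^ 2 * x ^ 2 * y ^ 2) := by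
          field_simp
          ring
        have : 0 ≤ (x - y) ^ 2 / ((x + y) ^ 2 * x ^ 2 * y ^ 2) := by positivity
        linarith
    _ = 2 / (n : ℝ) ^ 2 * (2 * ∑ i ∈ Finset.Ioo 0 n, ((i : ℝ) ^ 2)⁻¹) := by
        rw [← Finset.mul_sum, Finset.sum_add_distrib,
          sum_Ioo_zero_reflect (fun i => ((i : ℝ) ^ 2)⁻¹), two_mul (Finset.sum _ _)]
    _ ≤ 2 / (n : ℝ) ^ 2 * (2 * 2) := by gcongr
    _ = 8 / (n : ℝ) ^ 2 := by ring

/-- the majorant-series estimate of Kodaira–Morrow type: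
a(n) ≤ (16 C a(1))ⁿ / (16 C n²). -/
theorem stmt_12 (C : ℝ) (hC : 0 < C) (a : ℕ → ℝ)
    (ha : ∀ n, 0 ≤ a n) (h1 : 0 < a 1)
    (hrec : ∀ n, 2 ≤ n → a n ≤ C * ∑ i ∈ Finset.Ioo 0 n, a i * a (n - i)) :
    ∀ n, 1 ≤ n → a n ≤ (16 * C * a 1) ^ n / (16 * C * (n : ℝ) ^ 2) := by
  intro n
  induction n using Nat.strong_induction_on with
  | _ n ih =>
    intro hn
    obtain rfl | hn2 := hn.eq_or_lt
    · apply le_of_eq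
      field_simp
      simp
    set b := 16 * C * a 1 with hb
    have hb0 : 0 < b := by positivity
    calc a n ≤ C * ∑ i ∈ Finset.Ioo 0 n, a i * a (n - i) := hrec n hn2
      _ ≤ C * ∑ i ∈ Finset.Ioo 0 n, b ^ n / (16 * C) ^ 2 *
            (((i : ℝ) ^ 2)⁻¹ * (((n - i : ℕ) : ℝ) ^ 2)⁻¹) := by
          refine mul_le_mul_of_nonneg_left (Finset.sum_le_sum fun i hi => ?_) hC.le
          obtain ⟨h0, hin⟩ := Finset.mem_Ioo.mp hi
          refine (mul_le_mul (ih i hin h0) (ih (n - i) (by omega) (by omega)) (ha _)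
            (by positivity)).trans_eq ?_
          rw [← pow_mul_pow_sub b hin.le]
          simp only [div_eq_mul_inv, mul_inv, mul_pow]
          ring
      _ ≤ C * (b ^ n / (16 * C) ^ 2 * (16 / (n : ℝ) ^ 2)) := by
          rw [← Finset.mul_sum]
          gcongr
          refine (sum_Ioo_inv_sq_mul_inv_sq_le n).trans ?_
          gcongr
          norm_num
      _ = b ^ n / (16 * C * (n : ℝ) ^ 2) := by
          field_simp
end

section
/- Let C > 0 and let a : ℕ → ℝ be a sequence with a(n) ≥ 0 for all n, a(1) > 0, and a(n) ≤ C · Σ_{i=1}^{n-1} a(i) · a(n-i) for every n ≥ 2. Then for every real t with 0 ≤ t < 1/(16 C a(1)), the series Σ_{n≥1} a(n) tⁿ converges (the function n ↦ a(n) tⁿ is summable). -/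
theorem catalan_le_four_pow (n : ℕ) : catalan n ≤ 4 ^ n :=
  calc catalan n ≤ (n + 1) * catalan n := Nat.le_mul_of_pos_left _ n.succ_pos
    _ = n.centralBinom := succ_mul_catalan_eq_centralBinom n
    _ ≤ 4 ^ n := n.centralBinom_le_four_pow

theorem le_catalan_mul_of_le_convolution {C : ℝ} (hC : 0 ≤ C) {a : ℕ → ℝ} (ha : ∀ n, 0 ≤ a n)
    (hrec : ∀ n, 2 ≤ n → a n ≤ C * ∑ i ∈ Finset.Ioo 0 n, a i * a (n - i)) (n : ℕ) :
    a (n + 1) ≤ catalan n * C ^ n * a 1 ^ (n + 1) := by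
  induction n using Nat.strong_induction_on with
  | _ n ih =>
    cases n with
    | zero => simp
    | succ n =>
      have hsum : ∑ i ∈ Finset.Ioo 0 (n + 2), a i * a (n + 2 - i)
          = ∑ ij ∈ Finset.HasAntidiagonal.antidiagonal n, a (ij.1 + 1) * a (ij.2 + 1) := by
        refine Finset.sum_nbij' (fun i => (i - 1, n + 1 - i)) (fun ij => ij.1 + 1) ?_ ?_ ?_ ?_ ?_
        · intro i hi
          simp only [Finset.mem_Ioo, Finset.HasAntidiagonal.mem_antidiagonal] at *
          omega
        · intro ij hij
          simp only [Finset.mem_Ioo, Finset.HasAntidiagonal.mem_antidiagonal] at *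
          omega
        · intro i hi
          simp only [Finset.mem_Ioo] at *
          omega
        · rintro ⟨i, j⟩ hij
          simp only [Finset.HasAntidiagonal.mem_antidiagonal, Prod.mk.injEq] at *
          omega
        · intro i hi
          simp only [Finset.mem_Ioo] at hi
          congr 2 <;> omega
      calc a (n + 2) ≤ C * ∑ ij ∈ Finset.HasAntidiagonal.antidiagonal n, a (ij.1 + 1) * a (ij.2 + 1) :=
            hsum ▸ hrec (n + 2) (by omega)
        _ ≤ C * ∑ ij ∈ Finset.HasAntidiagonal.antidiagonal n,
              (catalan ij.1 * catalan ij.2 : ℝ) * (C ^ n * a 1 ^ (n + 2)) := by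
            refine mul_le_mul_of_nonneg_left (Finset.sum_le_sum ?_) hC
            rintro ⟨i, j⟩ hij
            obtain rfl : i + j = n := Finset.HasAntidiagonal.mem_antidiagonal.mp hij
            have h1 := ha 1
            calc a (i + 1) * a (j + 1)
                ≤ (catalan i * C ^ i * a 1 ^ (i + 1)) * (catalan j * C ^ j * a 1 ^ (j + 1)) :=
                  mul_le_mul (ih i (by omega)) (ih j (by omega)) (ha _) (by positivity)
              _ = _ := by ring
        _ = catalan (n + 1) * C ^ (n + 1) * a 1 ^ (n + 2) := by
            rw [← Finset.sum_mul, catalan_succ']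
            push_cast
            ring

/-- convergence of the power series Σ a(n) tⁿ for
0 ≤ t < 1/(16 C a(1)). -/
theorem stmt_13 (C : ℝ) (hC : 0 < C) (a : ℕ → ℝ)
    (ha : ∀ n, 0 ≤ a n) (h1 : 0 < a 1)
    (hrec : ∀ n, 2 ≤ n → a n ≤ C * ∑ i ∈ Finset.Ioo 0 n, a i * a (n - i)) :
    ∀ t : ℝ, 0 ≤ t → t < 1 / (16 * C * a 1) →
      Summable (fun n : ℕ => a n * t ^ n) := by
  intro t ht htlt
  have hr0 : 0 ≤ 4 * C * a 1 * t := by positivity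
  have hr1 : 4 * C * a 1 * t < 1 := by
    rw [lt_div_iff₀ (by positivity)] at htlt
    linarith
  rw [← summable_nat_add_iff 1]
  refine Summable.of_nonneg_of_le (fun n => mul_nonneg (ha _) (pow_nonneg ht _)) (fun n => ?_)
    ((summable_geometric_of_lt_one hr0 hr1).mul_left (a 1 * t))
  calc a (n + 1) * t ^ (n + 1)
      ≤ (catalan n * C ^ n * a 1 ^ (n + 1)) * t ^ (n + 1) := by
        gcongr
        exact le_catalan_mul_of_le_convolution hC.le ha hrec n
    _ ≤ (4 ^ n * C ^ n * a 1 ^ (n + 1)) * t ^ (n + 1) := by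
        gcongr
        exact_mod_cast catalan_le_four_pow n
    _ = a 1 * t * (4 * C * a 1 * t) ^ n := by
        rw [mul_pow, mul_pow, mul_pow]
        ring
end
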